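/- Let 1 < q < ∞, 0 < ε < 8^{-1/q}, and let (Ω, μ) be a measure space. If T : ℓ_q → L_q(μ) is a positive bounded linear operator which is ε-disjointness preserving, then there exists a disjointness preserving linear operator S : ℓ_q → L_q(μ) such that 0 ≤ S ≤ T and ‖T − S‖ ≤ 2^8·ε + 2·√(2·ε·‖T‖/3). -/

import Mathlib

open MeasureTheory ENNReal

section

open Filter Topology

theorem four_mul_sum_powerset_mul {ι : Type*} [DecidableEq ι] (s : Finset ι) (a : ι → ℝ) :
    4 * ∑ A ∈ s.powerset, (∑ i ∈ A, a i) * (∑ i ∈ s \ A, a i) =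
      2 ^ s.card * ((∑ i ∈ s, a i) ^ 2 - ∑ i ∈ s, a i ^ 2) := by
  induction s using Finset.induction_on with
  | empty => simp
  | insert i s hi ih =>
    have h : ∀ A ∈ s.powerset,
        (∑ j ∈ A, a j) * (∑ j ∈ insert i s \ A, a j) +
          (∑ j ∈ insert i A, a j) * (∑ j ∈ insert i s \ insert i A, a j) =
        2 * ((∑ j ∈ A, a j) * (∑ j ∈ s \ A, a j)) + a i * ∑ j ∈ s, a j := by
      intro A hA
      have hAs := Finset.mem_powerset.1 hA
      have hiA : i ∉ A := fun h => hi (hAs h)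
      rw [Finset.insert_sdiff_of_notMem _ hiA, Finset.sum_insert (by simp [hi]),
        Finset.sum_insert hiA, Finset.insert_sdiff_insert,
        Finset.sdiff_insert_of_notMem hi, ← Finset.sum_sdiff hAs]
      ring
    rw [Finset.sum_powerset_insert hi, ← Finset.sum_add_distrib, Finset.sum_congr rfl h,
      Finset.sum_add_distrib, ← Finset.mul_sum, Finset.sum_const, Finset.card_powerset,
      Finset.sum_insert hi, Finset.sum_insert hi, Finset.card_insert_of_notMem hi, mul_add,
      mul_left_comm, ih]
    simp only [nsmul_eq_mul]
    push_cast
    ring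

theorem exists_sum_le_average_min_add {ι : Type*} [DecidableEq ι] {s : Finset ι}
    (hs : s.Nonempty) {a : ι → ℝ} (ha : ∀ i ∈ s, 0 ≤ a i) :
    ∃ m ∈ s, ∑ i ∈ s, a i ≤
      4 / 2 ^ s.card * ∑ A ∈ s.powerset, min (∑ i ∈ A, a i) (∑ i ∈ s \ A, a i) + a m := by
  obtain ⟨m, hm, hmax⟩ := s.exists_max_image a hs
  refine ⟨m, hm, ?_⟩
  have hmin : ∀ A ∈ s.powerset, 0 ≤ min (∑ i ∈ A, a i) (∑ i ∈ s \ A, a i) := fun A hA =>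
    le_min (Finset.sum_nonneg fun i hi => ha i (Finset.mem_powerset.1 hA hi))
      (Finset.sum_nonneg fun i hi => ha i (Finset.sdiff_subset hi))
  set S := ∑ i ∈ s, a i with hS
  rcases (Finset.sum_nonneg ha).eq_or_lt with h0 | hpos
  · rw [← hS] at h0
    rw [← h0]
    exact add_nonneg (mul_nonneg (by positivity) (Finset.sum_nonneg hmin)) (ha m hm)
  · rw [← hS] at hpos
    have hprod : ∑ A ∈ s.powerset, (∑ i ∈ A, a i) * (∑ i ∈ s \ A, a i) ≤
        (∑ A ∈ s.powerset, min (∑ i ∈ A, a i) (∑ i ∈ s \ A, a i)) * S := by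
      rw [Finset.sum_mul]
      refine Finset.sum_le_sum fun A hA => ?_
      have hu : 0 ≤ ∑ i ∈ A, a i :=
        Finset.sum_nonneg fun i hi => ha i (Finset.mem_powerset.1 hA hi)
      have hv : 0 ≤ ∑ i ∈ s \ A, a i :=
        Finset.sum_nonneg fun i hi => ha i (Finset.sdiff_subset hi)
      rw [hS, ← Finset.sum_sdiff (Finset.mem_powerset.1 hA)]
      rcases le_total (∑ i ∈ A, a i) (∑ i ∈ s \ A, a i) with h | h
      · rw [min_eq_left h]; nlinarith
      · rw [min_eq_right h]; nlinarith
    have hsq : ∑ i ∈ s, a i ^ 2 ≤ a m * S := by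
      rw [hS, Finset.mul_sum]
      exact Finset.sum_le_sum fun i hi => by nlinarith [ha i hi, hmax i hi]
    have hc : (0 : ℝ) < 2 ^ s.card := by positivity
    have key := four_mul_sum_powerset_mul s a
    rw [← hS] at key
    rw [← sub_le_iff_le_add, div_mul_eq_mul_div, le_div_iff₀ hc]
    refine le_of_mul_le_mul_right ?_ hpos
    nlinarith

theorem exists_tendsto_inner_of_norm_le {H : Type*} [NormedAddCommGroup H]
    [InnerProductSpace ℝ H] [CompleteSpace H] (𝒰 : Ultrafilter ℕ) {u : ℕ → H} {R : ℝ}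
    (hu : ∀ n, ‖u n‖ ≤ R) :
    ∃ b : H, ∀ h, Tendsto (fun n => inner ℝ (u n) h) 𝒰 (𝓝 (inner ℝ b h)) := by
  let D : ℕ → WeakDual ℝ H := fun n => StrongDual.toWeakDual (InnerProductSpace.toDual ℝ H (u n))
  obtain ⟨ψ, -, hψ⟩ := (WeakDual.isCompact_closedBall (𝕜 := ℝ) (E := H) 0 R).ultrafilter_le_nhds
    (𝒰.map D) (by
      rw [le_principal_iff]
      refine mem_map.2 (Eventually.of_forall fun n => ?_)
      have : ‖InnerProductSpace.toDual ℝ H (u n)‖ ≤ R := by simpa using hu n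
      simpa [D] using this)
  refine ⟨(InnerProductSpace.toDual ℝ H).symm (WeakDual.toStrongDual ψ), fun h => ?_⟩
  have := ((WeakDual.eval_continuous h).tendsto ψ).comp (f := D) hψ
  rw [InnerProductSpace.toDual_symm_apply]
  exact this

theorem inner_indicator_toLp {Ω : Type*} [MeasurableSpace Ω] {μ : Measure Ω} (f : Lp ℝ 2 μ)
    {p : Ω → ℝ} (hp : MemLp p 2 μ) {E : Set Ω} (hE : MeasurableSet E) :
    inner ℝ f ((hp.indicator hE).toLp _) = ∫ ω in E, f ω * p ω ∂μ := by
  rw [L2.inner_def, ← integral_indicator hE]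
  refine integral_congr_ae ?_
  filter_upwards [(hp.indicator hE).coeFn_toLp] with ω hω
  rw [hω]
  by_cases h : ω ∈ E <;> simp [h, mul_comm]

theorem exists_measurable_selection {Ω : Type*} [MeasurableSpace Ω] {μ : Measure Ω}
    {G : ℕ → Ω → ℝ} (hGm : ∀ k, Measurable (G k)) (hG0 : ∀ k ω, 0 ≤ G k ω)
    (hGi : ∀ k, Integrable (G k) μ) {δ : ℝ}
    (h : ∀ n : ℕ, ∃ a : ℕ → Ω → ℝ, (∀ k, Measurable (a k)) ∧ (∀ k ω, 0 ≤ a k ω) ∧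
      (∀ k ω, a k ω ≤ 1) ∧ (∀ j k, j ≠ k → ∀ ω, a j ω + a k ω ≤ 1) ∧
      ∀ k < n, ∫ ω, G k ω * (1 - a k ω) ∂μ ≤ δ) :
    ∃ κ : Ω → ℕ, Measurable κ ∧ ∀ k, ∫ ω in {ω | κ ω ≠ k}, G k ω ∂μ ≤ 2 * δ := by
  classical
  choose a ham ha0 ha1 had haδ using h
  let P : ℕ → Ω → ℝ := fun k ω => √(G k ω)
  have hPm : ∀ k, Measurable (P k) := fun k => (hGm k).sqrt
  have hP0 : ∀ k ω, 0 ≤ P k ω := fun k ω => Real.sqrt_nonneg _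
  have hPP : ∀ k ω, P k ω * P k ω = G k ω := fun k ω => Real.mul_self_sqrt (hG0 k ω)
  have hP : ∀ k, MemLp (P k) 2 μ := fun k => by
    rw [memLp_two_iff_integrable_sq (hPm k).aestronglyMeasurable]
    simpa only [sq, hPP] using hGi k
  have haP : ∀ n k, MemLp (fun ω => a n k ω * P k ω) 2 μ := fun n k =>
    (hP k).mono ((ham n k).mul (hPm k)).aestronglyMeasurable (ae_of_all _ fun ω => by
      rw [Real.norm_eq_abs, Real.norm_eq_abs, abs_of_nonneg (hP0 k ω),
        abs_of_nonneg (mul_nonneg (ha0 n k ω) (hP0 k ω))]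
      exact mul_le_of_le_one_left (hP0 k ω) (ha1 n k ω))
  let u : ℕ → ℕ → Lp ℝ 2 μ := fun k n => (haP n k).toLp _
  have hu : ∀ k n, ‖u k n‖ ≤ ‖(hP k).toLp _‖ := fun k n => by
    refine Lp.norm_le_norm_of_ae_le ?_
    filter_upwards [(haP n k).coeFn_toLp, (hP k).coeFn_toLp] with ω h1 h2
    rw [h1, h2, Real.norm_eq_abs, Real.norm_eq_abs, abs_of_nonneg (hP0 k ω),
        abs_of_nonneg (mul_nonneg (ha0 n k ω) (hP0 k ω))]
    exact mul_le_of_le_one_left (hP0 k ω) (ha1 n k ω)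
  choose b hb using fun k => exists_tendsto_inner_of_norm_le (hyperfilter ℕ) (hu k)
  have hlim : ∀ j k {E : Set Ω}, MeasurableSet E →
      Tendsto (fun n => ∫ ω in E, a n j ω * P j ω * P k ω ∂μ) (hyperfilter ℕ)
        (𝓝 (∫ ω in E, b j ω * P k ω ∂μ)) := fun j k E hE => by
    have := hb j (((hP k).indicator hE).toLp _)
    rw [inner_indicator_toLp (b j) (hP k) hE] at this
    refine this.congr fun n => (inner_indicator_toLp (u j n) (hP k) hE).trans <| integral_congr_ae (ae_restrict_of_ae ?_)
    filter_upwards [(haP n j).coeFn_toLp] with ω h1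
    rw [h1]
  have hbP : ∀ j k, Integrable (fun ω => b j ω * P k ω) μ := fun j k =>
    (Lp.memLp (b j)).integrable_mul (hP k)
  have haPP : ∀ n j k, Integrable (fun ω => a n j ω * P j ω * P k ω) μ := fun n j k =>
    (haP n j).integrable_mul (hP k)
  have hPPi : ∀ j k, Integrable (fun ω => P j ω * P k ω) μ := fun j k =>
    (hP j).integrable_mul (hP k)
  have hle : ∀ k, ∀ᵐ ω ∂μ, b k ω * P k ω ≤ P k ω * P k ω := fun k => by
    refine ae_le_of_forall_setIntegral_le (hbP k k) (hPPi k k) fun E hE _ => ?_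
    refine le_of_tendsto (hlim k k hE) (Eventually.of_forall fun n => ?_)
    refine integral_mono (haPP n k k).integrableOn (hPPi k k).integrableOn fun ω => ?_
    exact mul_le_mul_of_nonneg_right (mul_le_of_le_one_left (hP0 k ω) (ha1 n k ω)) (hP0 k ω)
  have hpair : ∀ j k, j ≠ k →
      ∀ᵐ ω ∂μ, b j ω * P k ω + b k ω * P j ω ≤ P j ω * P k ω := fun j k hjk => by
    refine ae_le_of_forall_setIntegral_le ((hbP j k).add (hbP k j)) (hPPi j k) fun E hE _ => ?_
    rw [integral_add (hbP j k).integrableOn (hbP k j).integrableOn]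
    refine le_of_tendsto ((hlim j k hE).add (hlim k j hE)) (Eventually.of_forall fun n => ?_)
    rw [← integral_add (haPP n j k).integrableOn (haPP n k j).integrableOn]
    refine integral_mono ((haPP n j k).add (haPP n k j)).integrableOn
      (hPPi j k).integrableOn fun ω => ?_
    have := mul_le_mul_of_nonneg_right (had n j k hjk ω) (mul_nonneg (hP0 j ω) (hP0 k ω))
    dsimp only
    linarith
  have hint : ∀ k, ∫ ω, (P k ω * P k ω - b k ω * P k ω) ∂μ ≤ δ := fun k => by
    rw [integral_sub (hPPi k k) (hbP k k)]
    have := (hlim k k MeasurableSet.univ).const_sub (∫ ω, P k ω * P k ω ∂μ)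
    simp only [setIntegral_univ] at this
    refine le_of_tendsto this
      (((eventually_gt_atTop k).filter_mono Nat.hyperfilter_le_atTop).mono fun n hn => ?_)
    rw [← integral_sub (hPPi k k) (haPP n k k)]
    refine le_trans (le_of_eq (integral_congr_ae (ae_of_all _ fun ω => ?_))) (haδ n k hn)
    dsimp only
    rw [← hPP k ω]; ring
  let A : ℕ → Set Ω := fun k => {ω | P k ω / 2 < b k ω ∧ 0 < P k ω}
  have hA : ∀ k, MeasurableSet (A k) := fun k =>
    (measurableSet_lt ((hPm k).div_const 2) (Lp.stronglyMeasurable (b k)).measurable).inter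
      (measurableSet_lt measurable_const (hPm k))
  let p : Ω → ℕ → Prop := fun ω k => ω ∈ A k ∨ ∀ j, ω ∉ A j
  have hp : ∀ ω, ∃ k, p ω k := fun ω => by
    by_cases hω : ∃ k, ω ∈ A k
    · exact hω.imp fun k hk => Or.inl hk
    · exact ⟨0, Or.inr (not_exists.1 hω)⟩
  have hpm : ∀ k, MeasurableSet {ω | p ω k} := fun k => by
    have : {ω | p ω k} = A k ∪ ⋂ j, (A j)ᶜ := by ext ω; simp [p]
    rw [this]
    exact (hA k).union (MeasurableSet.iInter fun j => (hA j).compl)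
  have hκm : Measurable fun ω => Nat.find (hp ω) := measurable_find hp hpm
  refine ⟨_, hκm, fun k => ?_⟩
  have hκ : ∀ᵐ ω ∂μ, Nat.find (hp ω) ≠ k → ω ∉ A k := by
    have hall : ∀ᵐ ω ∂μ, ∀ j i, j ≠ i → b j ω * P i ω + b i ω * P j ω ≤ P j ω * P i ω := by
      rw [ae_all_iff]; intro j
      rw [ae_all_iff]; intro i
      by_cases hji : j = i
      · exact ae_of_all _ fun ω h => absurd hji h
      · filter_upwards [hpair j i hji] with ω hω _ using hω
    filter_upwards [hall] with ω hω hne hk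
    rcases Nat.find_spec (hp ω) with hj | hj
    · have := hω _ _ hne
      nlinarith [mul_lt_mul_of_pos_right hj.1 hk.2, mul_lt_mul_of_pos_right hk.1 hj.2]
    · exact hj k hk
  have hi : Integrable (fun ω => 2 * (P k ω * P k ω - b k ω * P k ω)) μ :=
    ((hPPi k k).sub (hbP k k)).const_mul 2
  calc ∫ ω in {ω | Nat.find (hp ω) ≠ k}, G k ω ∂μ
      ≤ ∫ ω in {ω | Nat.find (hp ω) ≠ k}, 2 * (P k ω * P k ω - b k ω * P k ω) ∂μ := by
        refine setIntegral_mono_on_ae (hGi k).integrableOn hi.integrableOn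
          (hκm (measurableSet_singleton k).compl) ?_
        filter_upwards [hκ] with ω hω hne
        rw [← hPP k ω]
        rcases (hP0 k ω).eq_or_lt with h0 | h0
        · simp [← h0]
        · have : b k ω ≤ P k ω / 2 := not_lt.1 fun hlt => hω hne ⟨hlt, h0⟩
          nlinarith [mul_le_mul_of_nonneg_right this h0.le]
    _ ≤ ∫ ω, 2 * (P k ω * P k ω - b k ω * P k ω) ∂μ := by
        refine setIntegral_le_integral hi ?_
        filter_upwards [hle k] with ω hω
        simp only [Pi.zero_apply]
        linarith
    _ ≤ 2 * δ := by
        rw [integral_const_mul]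
        linarith [hint k]

theorem exists_measurable_argmax {Ω : Type*} [MeasurableSpace Ω] {c : ℕ → Ω → ℝ}
    (hc : ∀ k, Measurable (c k)) {n : ℕ} (hn : 0 < n) :
    ∃ κ : Ω → ℕ, Measurable κ ∧ ∀ ω, κ ω < n ∧ ∀ j < n, c j ω ≤ c (κ ω) ω := by
  classical
  have hp : ∀ ω, ∃ k, k < n ∧ ∀ j < n, c j ω ≤ c k ω := fun ω => by
    obtain ⟨m, hm, hmax⟩ := (Finset.range n).exists_max_image (fun k => c k ω) ⟨0, by simpa⟩
    exact ⟨m, by simpa using hm, fun j hj => hmax j (by simpa using hj)⟩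
  refine ⟨fun ω => Nat.find (hp ω), measurable_find hp fun k => ?_, fun ω => Nat.find_spec (hp ω)⟩
  refine (MeasurableSet.const _).inter ?_
  have : {ω | ∀ j < n, c j ω ≤ c k ω} = ⋂ j, ⋂ _ : j < n, {ω | c j ω ≤ c k ω} := by
    ext ω; simp
  change MeasurableSet {ω | ∀ j < n, c j ω ≤ c k ω}
  rw [this]
  exact MeasurableSet.iInter fun j => MeasurableSet.iInter fun _ => measurableSet_le (hc j) (hc k)

theorem exists_fractional_partition {Ω : Type*} [MeasurableSpace Ω] {μ : Measure Ω}
    {G : ℕ → Ω → ℝ} (hGm : ∀ k, Measurable (G k)) (hGi : ∀ k, Integrable (G k) μ)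
    {δ δ' : ℝ} (hδ : δ < δ') (n : ℕ)
    (H : ∀ t : ℕ → ℝ, (∀ k, 0 ≤ t k) → 0 < ∑ k ∈ Finset.range n, t k →
      ∃ F : Ω → ℝ, Integrable F μ ∧ ∫ ω, F ω ∂μ ≤ δ * ∑ k ∈ Finset.range n, t k ∧
        ∀ᵐ ω ∂μ, ∃ m ∈ Finset.range n,
          ∑ k ∈ Finset.range n, t k * G k ω ≤ F ω + t m * G m ω) :
    ∃ a : ℕ → Ω → ℝ, (∀ k, Measurable (a k)) ∧ (∀ k ω, 0 ≤ a k ω) ∧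
      (∀ k ω, a k ω ≤ 1) ∧ (∀ j k, j ≠ k → ∀ ω, a j ω + a k ω ≤ 1) ∧
      ∀ k < n, ∫ ω, G k ω * (1 - a k ω) ∂μ ≤ δ' := by
  let IsPart : (ℕ → Ω → ℝ) → Prop := fun a => (∀ k, Measurable (a k)) ∧ (∀ k ω, 0 ≤ a k ω) ∧
    (∀ k ω, a k ω ≤ 1) ∧ (∀ j k, j ≠ k → ∀ ω, a j ω + a k ω ≤ 1)
  have hint : ∀ {a : ℕ → Ω → ℝ}, IsPart a → ∀ k, Integrable (fun ω => G k ω * (1 - a k ω)) μ :=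
    fun {a} ha k => (hGi k).mono
      ((hGm k).mul (measurable_const.sub (ha.1 k))).aestronglyMeasurable (ae_of_all _ fun ω => by
        rw [norm_mul]
        refine mul_le_of_le_one_right (norm_nonneg _) ?_
        rw [Real.norm_eq_abs, abs_le]
        constructor <;> linarith [ha.2.1 k ω, ha.2.2.1 k ω])
  let C : Set (Fin n → ℝ) := {v | ∃ a, IsPart a ∧ ∀ i : Fin n, ∫ ω, G i ω * (1 - a i ω) ∂μ ≤ v i}
  let D : Set (Fin n → ℝ) := {v | ∀ i, v i < δ'}
  have hCconv : Convex ℝ C := by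
    rintro v ⟨a, ha, hav⟩ w ⟨b, hb, hbw⟩ α β hα hβ hαβ
    refine ⟨fun k ω => α * a k ω + β * b k ω, ⟨fun k => ((ha.1 k).const_mul α).add
      ((hb.1 k).const_mul β), fun k ω => ?_, fun k ω => ?_, fun j k hjk ω => ?_⟩, fun i => ?_⟩
    · exact add_nonneg (mul_nonneg hα (ha.2.1 k ω)) (mul_nonneg hβ (hb.2.1 k ω))
    · nlinarith [ha.2.2.1 k ω, hb.2.2.1 k ω]
    · nlinarith [ha.2.2.2 j k hjk ω, hb.2.2.2 j k hjk ω]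
    · have : ∀ ω, G i ω * (1 - (α * a i ω + β * b i ω)) =
          α * (G i ω * (1 - a i ω)) + β * (G i ω * (1 - b i ω)) := fun ω => by
        linear_combination (-G i ω) * hαβ
      simp only [this]
      rw [integral_add ((hint ha i).const_mul α) ((hint hb i).const_mul β),
        integral_const_mul, integral_const_mul]
      exact add_le_add (mul_le_mul_of_nonneg_left (hav i) hα)
        (mul_le_mul_of_nonneg_left (hbw i) hβ)
  have hDconv : Convex ℝ D := by
    have : D = Set.univ.pi fun _ => Set.Iio δ' := by ext; simp [D]
    rw [this]
    exact convex_pi fun i _ => convex_Iio δ'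
  have hDopen : IsOpen D := by
    have : D = Set.univ.pi fun _ => Set.Iio δ' := by ext; simp [D]
    rw [this]
    exact isOpen_set_pi Set.finite_univ fun i _ => isOpen_Iio
  by_cases hdisj : Disjoint D C
  swap
  · obtain ⟨v, hvD, a, ha, hav⟩ := Set.not_disjoint_iff.1 hdisj
    exact ⟨a, ha.1, ha.2.1, ha.2.2.1, ha.2.2.2, fun k hk =>
      (hav ⟨k, hk⟩).trans (hvD ⟨k, hk⟩).le⟩
  exfalso
  obtain ⟨f, c, hfD, hfC⟩ := geometric_hahn_banach_open hDconv hDopen hCconv hdisj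
  let t : ℕ → ℝ := fun k => if h : k < n then f (Pi.single ⟨k, h⟩ 1) else 0
  have hf : ∀ v : ℕ → ℝ, f (fun i => v i) = ∑ k ∈ Finset.range n, t k * v k := fun v => by
    rw [Finset.sum_range]
    have := f.toLinearMap.pi_apply_eq_sum_univ fun i => v i
    simp only [ContinuousLinearMap.coe_coe] at this
    rw [this]
    refine Finset.sum_congr rfl fun i _ => ?_
    simp only [t, i.2, dif_pos, smul_eq_mul, mul_comm]
    congr 2
    ext j
    simp [Pi.single_apply, eq_comm]
  have hCmem : ∀ {a : ℕ → Ω → ℝ}, IsPart a →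
      (fun i : Fin n => ∫ ω, G i ω * (1 - a i ω) ∂μ) ∈ C := fun {a} ha => ⟨a, ha, fun i => le_rfl⟩
  have ht : ∀ k, 0 ≤ t k := fun k => by
    by_cases hk : k < n
    swap
    · simp [t, hk]
    by_contra! hneg
    have hz : IsPart fun _ _ => 0 := ⟨fun _ => measurable_const, by simp, by simp, by simp⟩
    set v : Fin n → ℝ := fun i => ∫ ω, G i ω * (1 - 0) ∂μ with hv
    have hs : ∀ s : ℝ, 0 ≤ s → c ≤ f v + s * t k := fun s hs => by
      have : v + s • Pi.single ⟨k, hk⟩ 1 ∈ C := by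
        refine ⟨_, hz, fun i => ?_⟩
        simp only [Pi.add_apply, Pi.smul_apply, smul_eq_mul]
        refine le_add_of_nonneg_right (mul_nonneg hs ?_)
        by_cases h : i = ⟨k, hk⟩ <;> simp [h]
      have := hfC _ this
      rw [map_add, map_smul, smul_eq_mul] at this
      simpa [t, hk] using this
    have h1 := hs 0 le_rfl
    have h2 := hs ((f v - c + 1) / (-t k)) (div_nonneg (by linarith) (by linarith))
    rw [div_mul_eq_mul_div, mul_div_assoc, div_neg, div_self hneg.ne] at h2
    linarith
  have hcD : δ * ∑ k ∈ Finset.range n, t k < c := by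
    have := hfD (fun i => (fun _ : ℕ => δ) i) (fun _ => hδ)
    rw [hf fun _ => δ] at this
    rwa [Finset.mul_sum, Finset.sum_congr rfl fun k _ => mul_comm δ (t k)]
  suffices ∃ a, IsPart a ∧
      ∑ k ∈ Finset.range n, t k * ∫ ω, G k ω * (1 - a k ω) ∂μ ≤
        δ * ∑ k ∈ Finset.range n, t k by
    obtain ⟨a, ha, hle⟩ := this
    have := hfC _ (hCmem ha)
    rw [hf fun k => ∫ ω, G k ω * (1 - a k ω) ∂μ] at this
    linarith
  rcases (Finset.sum_nonneg fun k _ => ht k : 0 ≤ ∑ k ∈ Finset.range n, t k).eq_or_lt with h0 | hpos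
  · refine ⟨fun _ _ => 0, ⟨fun _ => measurable_const, by simp, by simp, by simp⟩, ?_⟩
    have h0' := (Finset.sum_eq_zero_iff_of_nonneg fun k _ => ht k).1 h0.symm
    rw [← h0, Finset.sum_eq_zero fun k hk => by rw [h0' k hk, zero_mul], mul_zero]
  · have hn : 0 < n := by
      rcases n.eq_zero_or_pos with rfl | h
      · simp at hpos
      · exact h
    obtain ⟨F, hFi, hFδ, hF⟩ := H t ht hpos
    obtain ⟨κ, hκm, hκ⟩ := exists_measurable_argmax (fun k => (hGm k).const_mul (t k)) hn
    have hpart : IsPart fun k ω => if κ ω = k then 1 else 0 := by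
      refine ⟨fun k => Measurable.ite (hκm (measurableSet_singleton k)) measurable_const
        measurable_const, fun k ω => ?_, fun k ω => ?_, fun j k hjk ω => ?_⟩
      · dsimp only; split_ifs <;> simp
      · dsimp only; split_ifs <;> simp
      · by_cases hj : κ ω = j
        · simp [hj, hjk]
        · simp only [hj, if_false, zero_add]
          split_ifs <;> simp
    refine ⟨_, hpart, le_trans ?_ hFδ⟩
    simp only [← integral_const_mul]
    rw [← integral_finsetSum _ fun k _ => (hint hpart k).const_mul (t k)]
    refine integral_mono_ae
      (integrable_finsetSum _ fun k _ => (hint hpart k).const_mul (t k)) hFi ?_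
    filter_upwards [hF] with ω ⟨m, hm, hω⟩
    have hsum : ∑ k ∈ Finset.range n, t k * (G k ω * (1 - if κ ω = k then 1 else 0)) =
        ∑ k ∈ Finset.range n, t k * G k ω - t (κ ω) * G (κ ω) ω := by
      rw [← Finset.sum_erase_add _ _ (Finset.mem_range.2 (hκ ω).1),
        ← Finset.sum_erase_add _ (fun k => t k * G k ω) (Finset.mem_range.2 (hκ ω).1)]
      simp only [if_true, sub_self, mul_zero, add_zero, add_sub_cancel_right]
      refine Finset.sum_congr rfl fun k hk => ?_
      rw [if_neg (Finset.ne_of_mem_erase hk).symm, sub_zero, mul_one]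
    rw [hsum]
    linarith [(hκ ω).2 m (Finset.mem_range.1 hm)]

theorem sum_rpow_le_rpow_sum {ι : Type*} (s : Finset ι) {a : ι → ℝ}
    (ha : ∀ i ∈ s, 0 ≤ a i) {q : ℝ} (hq : 1 ≤ q) :
    ∑ i ∈ s, a i ^ q ≤ (∑ i ∈ s, a i) ^ q := by
  classical
  induction s using Finset.induction_on with
  | empty => simp [Real.zero_rpow (by linarith : q ≠ 0)]
  | insert i s hi ih =>
    have hs : ∀ j ∈ s, 0 ≤ a j := fun j hj => ha j (Finset.mem_insert_of_mem hj)
    rw [Finset.sum_insert hi, Finset.sum_insert hi]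
    exact (add_le_add_right (ih hs) _).trans
      (Real.add_rpow_le_rpow_add (ha i (Finset.mem_insert_self i s)) (Finset.sum_nonneg hs) hq)

theorem Lp_norm_rpow_eq_integral {Ω : Type*} [MeasurableSpace Ω] {μ : Measure Ω} {p : ℝ≥0∞}
    [hp1 : Fact (1 ≤ p)] (hp : p ≠ ∞) (f : Lp ℝ p μ) :
    ‖f‖ ^ p.toReal = ∫ ω, |f ω| ^ p.toReal ∂μ := by
  have hp0 : p ≠ 0 := (zero_lt_one.trans_le hp1.out).ne'
  have hI : 0 ≤ ∫ ω, ‖f ω‖ ^ p.toReal ∂μ := integral_nonneg fun ω => by positivity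
  rw [Lp.norm_def, (Lp.memLp f).eLpNorm_eq_integral_rpow_norm hp0 hp,
    ENNReal.toReal_ofReal (by positivity), Real.rpow_inv_rpow hI (toReal_pos hp0 hp).ne']
  rfl

/-- The `k`-th unit vector of `ℓ_p`. -/
noncomputable def unitVec (p : ℝ≥0∞) (k : ℕ) : Lp ℝ p (Measure.count : Measure ℕ) :=
  indicatorConstLp p (measurableSet_singleton k) (by simp) 1

theorem unitVec_apply (p : ℝ≥0∞) (k j : ℕ) : unitVec p k j = if j = k then 1 else 0 := by
  have := Measure.ae_count_iff.1 (indicatorConstLp_coeFn (p := p) (μ := Measure.count)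
    (hs := measurableSet_singleton k) (hμs := by simp) (c := (1 : ℝ))) j
  rw [unitVec, this]
  by_cases h : j = k <;> simp [h]

theorem sum_smul_unitVec_apply (p : ℝ≥0∞) (s : Finset ℕ) (c : ℕ → ℝ) (j : ℕ) :
    (∑ k ∈ s, c k • unitVec p k : Lp ℝ p (Measure.count : Measure ℕ)) j =
      if j ∈ s then c j else 0 := by
  have h1 := Measure.ae_count_iff.1 (Lp.coeFn_finsetSum s fun k => c k • unitVec p k) j
  have h2 : ∀ k, (c k • unitVec p k : Lp ℝ p (Measure.count : Measure ℕ)) j =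
      if j = k then c k else 0 := fun k => by
    have := Measure.ae_count_iff.1 (Lp.coeFn_smul (c k) (unitVec p k)) j
    rw [this]
    simp [unitVec_apply]
  rw [h1, Finset.sum_apply]
  simp [h2]

theorem Lp_count_le_iff {p : ℝ≥0∞} {x y : Lp ℝ p (Measure.count : Measure ℕ)} :
    x ≤ y ↔ ∀ k, x k ≤ y k := by
  rw [← Lp.coeFn_le]
  exact Measure.ae_count_iff

theorem Lp_count_abs_apply {p : ℝ≥0∞} (x : Lp ℝ p (Measure.count : Measure ℕ)) (k : ℕ) :
    |x| k = |x k| :=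
  Measure.ae_count_iff.1 (Lp.coeFn_abs x) k

theorem Lp_count_abs_inf_abs_eq_zero_iff {p : ℝ≥0∞}
    {x y : Lp ℝ p (Measure.count : Measure ℕ)} :
    |x| ⊓ |y| = 0 ↔ ∀ k, x k = 0 ∨ y k = 0 := by
  rw [Lp.ext_iff]
  refine Measure.ae_count_iff.trans (forall_congr' fun k => ?_)
  rw [Measure.ae_count_iff.1 (Lp.coeFn_inf |x| |y|) k,
    Measure.ae_count_iff.1 (Lp.coeFn_zero ℝ p Measure.count) k, Pi.inf_apply,
    Lp_count_abs_apply, Lp_count_abs_apply]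
  constructor
  · intro h
    rcases min_choice |x k| |y k| with h' | h'
    · exact Or.inl (abs_eq_zero.1 (h'.symm.trans h))
    · exact Or.inr (abs_eq_zero.1 (h'.symm.trans h))
  · rintro (h | h) <;> simp [h]

theorem norm_sum_smul_unitVec_rpow {p : ℝ≥0∞} [hp1 : Fact (1 ≤ p)] (hp : p ≠ ∞)
    (s : Finset ℕ) (c : ℕ → ℝ) :
    ‖∑ k ∈ s, c k • unitVec p k‖ ^ p.toReal = ∑ k ∈ s, |c k| ^ p.toReal := by
  have hp0 : p ≠ 0 := (zero_lt_one.trans_le hp1.out).ne'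
  have hq : p.toReal ≠ 0 := (toReal_pos hp0 hp).ne'
  have hi := (integrable_norm_rpow_iff (Lp.memLp (∑ k ∈ s, c k • unitVec p k)).1 hp0 hp).2
    (Lp.memLp _)
  simp only [Real.norm_eq_abs] at hi
  rw [Lp_norm_rpow_eq_integral hp, integral_countable hi, tsum_eq_sum (s := s)]
  · refine Finset.sum_congr rfl fun k hk => ?_
    rw [sum_smul_unitVec_apply]; simp [hk]
  · intro k hk
    rw [sum_smul_unitVec_apply]; simp [hk, Real.zero_rpow hq]

theorem dense_span_unitVec {p : ℝ≥0∞} [hp1 : Fact (1 ≤ p)] (hp : p ≠ ∞) :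
    Dense (Set.range fun v : Finset ℕ × (ℕ → ℝ) => ∑ k ∈ v.1, v.2 k • unitVec p k) := by
  have hspan : (Submodule.span ℝ (Set.range (unitVec p)) : Set (Lp ℝ p Measure.count)) ⊆
      Set.range fun v : Finset ℕ × (ℕ → ℝ) => ∑ k ∈ v.1, v.2 k • unitVec p k := by
    intro x hx
    obtain ⟨c, rfl⟩ := Finsupp.mem_span_range_iff_exists_finsupp.1 hx
    exact ⟨(c.support, c), rfl⟩
  refine Dense.mono hspan ?_
  rw [Submodule.dense_iff_topologicalClosure_eq_top, eq_top_iff]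
  rintro x -
  induction x using Lp.induction hp with
  | indicatorConst c hs hμs =>
    rename_i s
    have hfin : s.Finite := Measure.count_apply_lt_top.1 hμs
    refine Submodule.le_topologicalClosure _ ?_
    have : (Lp.simpleFunc.indicatorConst p hs hμs.ne c : Lp ℝ p Measure.count) =
        ∑ k ∈ hfin.toFinset, c • unitVec p k := by
      refine Lp.ext (Measure.ae_count_iff.2 fun k => ?_)
      rw [sum_smul_unitVec_apply p _ fun _ => c, Lp.simpleFunc.coe_indicatorConst,
        Measure.ae_count_iff.1 indicatorConstLp_coeFn k]
      by_cases hk : k ∈ s <;> simp [hk]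
    rw [this]
    exact Submodule.sum_mem _ fun k _ =>
      Submodule.smul_mem _ _ (Submodule.subset_span ⟨k, rfl⟩)
  | add hf hg _ h1 h2 => exact Submodule.add_mem _ h1 h2
  | isClosed => exact Submodule.isClosed_topologicalClosure _

theorem map_sum_smul_unitVec_ae {Ω : Type*} [MeasurableSpace Ω] {μ : Measure Ω} {p : ℝ≥0∞}
    [Fact (1 ≤ p)] (T : Lp ℝ p (Measure.count : Measure ℕ) →L[ℝ] Lp ℝ p μ) (c : ℕ → ℝ) :
    ∀ᵐ ω ∂μ, ∀ A : Finset ℕ,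
      T (∑ k ∈ A, c k • unitVec p k) ω = ∑ k ∈ A, c k * T (unitVec p k) ω := by
  rw [ae_all_iff]
  intro A
  have h : ∀ᵐ ω ∂μ, ∀ k, (c k • T (unitVec p k)) ω = c k * T (unitVec p k) ω := by
    rw [ae_all_iff]
    exact fun k => Lp.coeFn_smul (c k) (T (unitVec p k))
  rw [map_sum]
  simp only [map_smul]
  filter_upwards [h, Lp.coeFn_finsetSum A fun k => c k • T (unitVec p k)] with ω h1 h2
  rw [h2, Finset.sum_apply]
  exact Finset.sum_congr rfl fun k _ => h1 k

theorem unitVec_nonneg (p : ℝ≥0∞) (k : ℕ) : 0 ≤ unitVec p k := by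
  refine Lp_count_le_iff.2 fun j => ?_
  rw [Measure.ae_count_iff.1 (Lp.coeFn_zero ℝ p Measure.count) j, unitVec_apply]
  split_ifs <;> simp

theorem map_unitVec_nonneg_ae {Ω : Type*} [MeasurableSpace Ω] {μ : Measure Ω} {p : ℝ≥0∞}
    [Fact (1 ≤ p)] {T : Lp ℝ p (Measure.count : Measure ℕ) →L[ℝ] Lp ℝ p μ}
    (hpos : ∀ x, 0 ≤ x → 0 ≤ T x) : ∀ᵐ ω ∂μ, ∀ k, 0 ≤ T (unitVec p k) ω := by
  rw [ae_all_iff]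
  exact fun k => (Lp.coeFn_nonneg _).2 (hpos _ (unitVec_nonneg p k))

theorem exists_norm_le_and_sum_le_add {Ω : Type*} [MeasurableSpace Ω] {μ : Measure Ω}
    {p : ℝ≥0∞} [Fact (1 ≤ p)] {ε : ℝ} (hε : 0 ≤ ε)
    {T : Lp ℝ p (Measure.count : Measure ℕ) →L[ℝ] Lp ℝ p μ}
    (hpos : ∀ x, 0 ≤ x → 0 ≤ T x)
    (hDP : ∀ x y, |x| ⊓ |y| = 0 → ‖|T x| ⊓ |T y|‖ ≤ ε * max ‖x‖ ‖y‖)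
    {s : Finset ℕ} (hs : s.Nonempty) {c : ℕ → ℝ} (hc : ∀ k, 0 ≤ c k) :
    ∃ E : Lp ℝ p μ, ‖E‖ ≤ 4 * ε * ‖∑ k ∈ s, c k • unitVec p k‖ ∧
      ∀ᵐ ω ∂μ, 0 ≤ E ω ∧ ∃ m ∈ s,
        ∑ k ∈ s, c k * T (unitVec p k) ω ≤ E ω + c m * T (unitVec p m) ω := by
  classical
  let X : Finset ℕ → Lp ℝ p (Measure.count : Measure ℕ) := fun A => ∑ k ∈ A, c k • unitVec p k
  let M : Finset ℕ → Lp ℝ p μ := fun A => |T (X A)| ⊓ |T (X (s \ A))|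
  have hXle : ∀ A ⊆ s, ‖X A‖ ≤ ‖X s‖ := fun A hA => by
    refine norm_le_norm_of_abs_le_abs (Lp_count_le_iff.2 fun j => ?_)
    rw [Lp_count_abs_apply, Lp_count_abs_apply, sum_smul_unitVec_apply, sum_smul_unitVec_apply]
    by_cases hj : j ∈ A
    · simp [hj, hA hj]
    · simp [hj]
  have hM : ∀ A ∈ s.powerset, ‖M A‖ ≤ ε * ‖X s‖ := fun A hA => by
    rw [Finset.mem_powerset] at hA
    refine (hDP _ _ (Lp_count_abs_inf_abs_eq_zero_iff.2 fun k => ?_)).trans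
      (mul_le_mul_of_nonneg_left (max_le (hXle A hA) (hXle _ Finset.sdiff_subset)) hε)
    rw [sum_smul_unitVec_apply, sum_smul_unitVec_apply]
    by_cases hk : k ∈ A <;> simp [hk]
  refine ⟨(4 / 2 ^ s.card : ℝ) • ∑ A ∈ s.powerset, M A, ?_, ?_⟩
  · rw [norm_smul, Real.norm_of_nonneg (by positivity)]
    have := (norm_sum_le s.powerset M).trans (Finset.sum_le_card_nsmul _ _ _ hM)
    rw [Finset.card_powerset, nsmul_eq_mul] at this
    push_cast at this
    calc 4 / 2 ^ s.card * ‖∑ A ∈ s.powerset, M A‖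
        ≤ 4 / 2 ^ s.card * (2 ^ s.card * (ε * ‖X s‖)) :=
          mul_le_mul_of_nonneg_left this (by positivity)
      _ = 4 * ε * ‖X s‖ := by field_simp
  · have hMω : ∀ᵐ ω ∂μ, ∀ A, M A ω = min |T (X A) ω| |T (X (s \ A)) ω| := by
      rw [ae_all_iff]
      intro A
      filter_upwards [Lp.coeFn_inf |T (X A)| |T (X (s \ A))|, Lp.coeFn_abs (T (X A)),
        Lp.coeFn_abs (T (X (s \ A)))] with ω h1 h2 h3
      rw [h1, Pi.inf_apply, h2, h3]
    filter_upwards [Lp.coeFn_smul (4 / 2 ^ s.card : ℝ) (∑ A ∈ s.powerset, M A),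
      Lp.coeFn_finsetSum s.powerset M, hMω, map_sum_smul_unitVec_ae T c,
      map_unitVec_nonneg_ae hpos] with ω h1 h2 h3 h4 h5
    have h0 : ∀ k, 0 ≤ c k * T (unitVec p k) ω := fun k => mul_nonneg (hc k) (h5 k)
    have hE : ((4 / 2 ^ s.card : ℝ) • ∑ A ∈ s.powerset, M A : Lp ℝ p μ) ω =
        4 / 2 ^ s.card * ∑ A ∈ s.powerset, min (∑ k ∈ A, c k * T (unitVec p k) ω)
          (∑ k ∈ s \ A, c k * T (unitVec p k) ω) := by
      rw [h1, Pi.smul_apply, smul_eq_mul, h2, Finset.sum_apply]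
      congr 1
      refine Finset.sum_congr rfl fun A _ => ?_
      rw [h3, h4, h4, abs_of_nonneg (Finset.sum_nonneg fun k _ => h0 k),
        abs_of_nonneg (Finset.sum_nonneg fun k _ => h0 k)]
    rw [hE]
    refine ⟨mul_nonneg (by positivity) (Finset.sum_nonneg fun A _ =>
      le_min (Finset.sum_nonneg fun k _ => h0 k) (Finset.sum_nonneg fun k _ => h0 k)), ?_⟩
    exact exists_sum_le_average_min_add hs fun k _ => h0 k

/-- The operator `x ↦ x (κ ·) * T e_{κ ·}` obtained from a positive operator `T` by keeping at
each point only the coordinate picked by `κ`. -/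
theorem exists_selection_operator {Ω : Type*} [MeasurableSpace Ω] {μ : Measure Ω}
    {p : ℝ≥0∞} [Fact (1 ≤ p)]
    {T : Lp ℝ p (Measure.count : Measure ℕ) →L[ℝ] Lp ℝ p μ}
    (hpos : ∀ x, 0 ≤ x → 0 ≤ T x) {κ : Ω → ℕ} (hκ : Measurable κ) :
    ∃ S : Lp ℝ p (Measure.count : Measure ℕ) →L[ℝ] Lp ℝ p μ,
      (∀ x, ∀ᵐ ω ∂μ, S x ω = x (κ ω) * T (unitVec p (κ ω)) ω) ∧
      ∀ x, 0 ≤ x → S x ≤ T x := by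
  have hdom : ∀ x, 0 ≤ x → ∀ᵐ ω ∂μ, ∀ k, x k * T (unitVec p k) ω ≤ T x ω := fun x hx => by
    rw [ae_all_iff]
    intro k
    have hle : x k • unitVec p k ≤ x := Lp_count_le_iff.2 fun j => by
      have h0 := Lp_count_le_iff.1 hx j
      rw [Measure.ae_count_iff.1 (Lp.coeFn_zero ℝ p Measure.count) j] at h0
      rw [Measure.ae_count_iff.1 (Lp.coeFn_smul (x k) (unitVec p k)) j, Pi.smul_apply,
        unitVec_apply, smul_eq_mul]
      split_ifs with h
      · rw [h, mul_one]
      · simpa using h0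
    have hT : T (x k • unitVec p k) ≤ T x := by
      have := hpos _ (sub_nonneg.2 hle)
      rwa [map_sub, sub_nonneg] at this
    rw [map_smul] at hT
    filter_upwards [(Lp.coeFn_le _ _).2 hT, Lp.coeFn_smul (x k) (T (unitVec p k))] with ω h1 h2
    rw [h2] at h1
    exact h1
  let φ : Lp ℝ p (Measure.count : Measure ℕ) → Ω → ℝ :=
    fun x ω => x (κ ω) * T (unitVec p (κ ω)) ω
  have hφm : ∀ x, Measurable (φ x) := fun x => by
    have : Measurable fun z : ℕ × Ω => x z.1 * T (unitVec p z.1) z.2 :=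
      measurable_from_prod_countable_right fun k =>
        (Lp.stronglyMeasurable (T (unitVec p k))).measurable.const_mul (x k)
    exact this.comp (hκ.prodMk measurable_id)
  have hφle : ∀ x, ∀ᵐ ω ∂μ, ‖φ x ω‖ ≤ ‖T |x| ω‖ := fun x => by
    filter_upwards [hdom |x| (abs_nonneg x), map_unitVec_nonneg_ae hpos] with ω h1 h2
    have := h1 (κ ω)
    rw [Lp_count_abs_apply] at this
    rw [norm_mul, Real.norm_of_nonneg (h2 _)]
    exact this.trans (le_abs_self _)
  have hφ : ∀ x, MemLp (φ x) p μ := fun x =>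
    (Lp.memLp (T |x|)).mono (hφm x).aestronglyMeasurable (hφle x)
  let S₀ : Lp ℝ p (Measure.count : Measure ℕ) →ₗ[ℝ] Lp ℝ p μ :=
    { toFun := fun x => (hφ x).toLp _
      map_add' := fun x y => by
        rw [← MemLp.toLp_add]
        refine MemLp.toLp_congr _ _ (ae_of_all _ fun ω => ?_)
        simp only [φ, Pi.add_apply]
        rw [Measure.ae_count_iff.1 (Lp.coeFn_add x y) (κ ω), Pi.add_apply, add_mul]
      map_smul' := fun r x => by
        rw [RingHom.id_apply, ← MemLp.toLp_const_smul]
        refine MemLp.toLp_congr _ _ (ae_of_all _ fun ω => ?_)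
        simp only [φ, Pi.smul_apply, smul_eq_mul]
        rw [Measure.ae_count_iff.1 (Lp.coeFn_smul r x) (κ ω), Pi.smul_apply, smul_eq_mul,
          mul_assoc] }
  refine ⟨S₀.mkContinuous ‖T‖ fun x => ?_, fun x => (hφ x).coeFn_toLp, fun x hx => ?_⟩
  · have h : ‖S₀ x‖ ≤ ‖T |x|‖ := by
      refine Lp.norm_le_norm_of_ae_le ?_
      filter_upwards [hφle x, (hφ x).coeFn_toLp] with ω h1 h2
      rwa [← h2] at h1
    refine h.trans ((T.le_opNorm _).trans_eq ?_)
    rw [norm_abs_eq_norm]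
  · refine (Lp.coeFn_le _ _).1 ?_
    filter_upwards [hdom x hx, (hφ x).coeFn_toLp] with ω h1 h2
    exact h2.trans_le (h1 (κ ω))

theorem exists_selection_of_almost_disjointness_preserving {Ω : Type*} [MeasurableSpace Ω]
    {μ : Measure Ω} {p : ℝ≥0∞} [hp1 : Fact (1 ≤ p)] (hp : p ≠ ∞) {ε : ℝ} (hε : 0 < ε)
    {T : Lp ℝ p (Measure.count : Measure ℕ) →L[ℝ] Lp ℝ p μ}
    (hpos : ∀ x, 0 ≤ x → 0 ≤ T x)
    (hDP : ∀ x y, |x| ⊓ |y| = 0 → ‖|T x| ⊓ |T y|‖ ≤ ε * max ‖x‖ ‖y‖) :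
    ∃ κ : Ω → ℕ, Measurable κ ∧
      ∀ k, ∫ ω in {ω | κ ω ≠ k}, |T (unitVec p k) ω| ^ p.toReal ∂μ ≤
        (16 * ε) ^ p.toReal := by
  have hp0 : p ≠ 0 := (zero_lt_one.trans_le hp1.out).ne'
  have hq1 : 1 ≤ p.toReal := by
    rw [← ENNReal.toReal_one]
    exact (ENNReal.toReal_le_toReal one_ne_top hp).2 hp1.out
  set q := p.toReal with hq
  have hq0 : q ≠ 0 := by linarith
  have hGm : ∀ k, Measurable fun ω => |T (unitVec p k) ω| ^ q := fun k =>
    ((Lp.stronglyMeasurable (T (unitVec p k))).measurable.norm).pow_const q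
  have hLi : ∀ f : Lp ℝ p μ, Integrable (fun ω => |f ω| ^ q) μ := fun f =>
    (integrable_norm_rpow_iff (Lp.memLp f).1 hp0 hp).2 (Lp.memLp f)
  have hδ : (4 * ε) ^ q < 2 * (4 * ε) ^ q := by
    linarith [Real.rpow_pos_of_pos (by linarith : 0 < 4 * ε) q]
  obtain ⟨κ, hκ, hle⟩ := exists_measurable_selection hGm (fun k ω => by positivity)
    (fun k => hLi _) fun n =>
      exists_fractional_partition (μ := μ) hGm (fun k => hLi _) hδ n fun t ht htpos => by
    have hne : (Finset.range n).Nonempty := by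
      by_contra h
      rw [Finset.not_nonempty_iff_eq_empty.1 h] at htpos
      simp at htpos
    have hx : ∀ k, 0 ≤ t k ^ q⁻¹ := fun k => Real.rpow_nonneg (ht k) _
    obtain ⟨E, hE, hEω⟩ := exists_norm_le_and_sum_le_add hε.le hpos hDP hne hx
    refine ⟨_, hLi E, ?_, ?_⟩
    · rw [← Lp_norm_rpow_eq_integral hp]
      refine (Real.rpow_le_rpow (norm_nonneg _) hE (by linarith)).trans_eq ?_
      rw [Real.mul_rpow (by positivity) (norm_nonneg _), norm_sum_smul_unitVec_rpow hp]
      congr 1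
      refine Finset.sum_congr rfl fun k _ => ?_
      rw [abs_of_nonneg (hx k), Real.rpow_inv_rpow (ht k) hq0]
    · filter_upwards [hEω, map_unitVec_nonneg_ae hpos] with ω ⟨h0, m, hm, h1⟩ h2
      refine ⟨m, hm, ?_⟩
      have hterm : ∀ k, t k * |T (unitVec p k) ω| ^ q =
          (t k ^ q⁻¹ * T (unitVec p k) ω) ^ q := fun k => by
        rw [abs_of_nonneg (h2 k), Real.mul_rpow (hx k) (h2 k), Real.rpow_inv_rpow (ht k) hq0]
      have ha : ∀ k, 0 ≤ t k ^ q⁻¹ * T (unitVec p k) ω := fun k => mul_nonneg (hx k) (h2 k)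
      simp only [hterm]
      rw [← Finset.sum_erase_add _ _ hm] at h1 ⊢
      rw [add_le_add_iff_right] at h1 ⊢
      rw [abs_of_nonneg h0]
      exact (sum_rpow_le_rpow_sum _ (fun k _ => ha k) hq1).trans
        (Real.rpow_le_rpow (Finset.sum_nonneg fun k _ => ha k) h1 (by linarith))
  refine ⟨κ, hκ, fun k => (hle k).trans ?_⟩
  have h4 : (4 : ℝ) ≤ 4 ^ q := by
    simpa using Real.rpow_le_rpow_of_exponent_le (by norm_num : (1 : ℝ) ≤ 4) hq1
  have : (16 * ε) ^ q = 4 ^ q * (4 * ε) ^ q := by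
    rw [← Real.mul_rpow (by norm_num) (by positivity)]
    ring_nf
  rw [this, ← mul_assoc]
  exact mul_le_mul_of_nonneg_right (by linarith) (by positivity)

theorem norm_sub_selection_apply_sum_le {Ω : Type*} [MeasurableSpace Ω] {μ : Measure Ω}
    {p : ℝ≥0∞} [hp1 : Fact (1 ≤ p)] (hp : p ≠ ∞) {ε : ℝ} (hε : 0 ≤ ε)
    {T S : Lp ℝ p (Measure.count : Measure ℕ) →L[ℝ] Lp ℝ p μ}
    (hpos : ∀ x, 0 ≤ x → 0 ≤ T x)
    (hDP : ∀ x y, |x| ⊓ |y| = 0 → ‖|T x| ⊓ |T y|‖ ≤ ε * max ‖x‖ ‖y‖)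
    {κ : Ω → ℕ} (hκ : Measurable κ) {η : ℝ} (hη : 0 ≤ η)
    (hκη : ∀ k, ∫ ω in {ω | κ ω ≠ k}, |T (unitVec p k) ω| ^ p.toReal ∂μ ≤ η ^ p.toReal)
    (hS : ∀ x, ∀ᵐ ω ∂μ, S x ω = x (κ ω) * T (unitVec p (κ ω)) ω)
    (s : Finset ℕ) (c : ℕ → ℝ) :
    ‖(T - S) (∑ k ∈ s, c k • unitVec p k)‖ ≤
      (4 * ε + η) * ‖∑ k ∈ s, c k • unitVec p k‖ := by
  rcases s.eq_empty_or_nonempty with rfl | hs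
  · simp
  have hp0 : p ≠ 0 := (zero_lt_one.trans_le hp1.out).ne'
  have hqpos : 0 < p.toReal := toReal_pos hp0 hp
  set q := p.toReal with hq
  have hnorm : ‖∑ k ∈ s, |c k| • unitVec p k‖ = ‖∑ k ∈ s, c k • unitVec p k‖ := by
    refine (Real.rpow_left_inj (norm_nonneg _) (norm_nonneg _) hqpos.ne').1 ?_
    simp only [hq, norm_sum_smul_unitVec_rpow hp, abs_abs]
  obtain ⟨E, hE, hEω⟩ :=
    exists_norm_le_and_sum_le_add hε hpos hDP hs (c := fun k => |c k|) fun k => abs_nonneg _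
  rw [hnorm] at hE
  let A : ℕ → Set Ω := fun k => {ω | κ ω ≠ k}
  have hA : ∀ k, MeasurableSet (A k) := fun k => hκ (measurableSet_singleton k).compl
  let V : Ω → ℝ := fun ω =>
    ∑ k ∈ s, |c k| ^ q * (A k).indicator (fun ω => |T (unitVec p k) ω| ^ q) ω
  have hVterm : ∀ k ω,
      0 ≤ |c k| ^ q * (A k).indicator (fun ω => |T (unitVec p k) ω| ^ q) ω := fun k ω =>
    mul_nonneg (by positivity) (Set.indicator_nonneg (fun _ _ => by positivity) _)
  have hV0 : ∀ ω, 0 ≤ V ω := fun ω => Finset.sum_nonneg fun k _ => hVterm k ω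
  have hGi : ∀ k, Integrable ((A k).indicator fun ω => |T (unitVec p k) ω| ^ q) μ := fun k =>
    ((integrable_norm_rpow_iff (Lp.memLp (T (unitVec p k))).1 hp0 hp).2
      (Lp.memLp _)).indicator (hA k)
  have hVi : Integrable V μ := integrable_finsetSum _ fun k _ => (hGi k).const_mul _
  have hVint : ∫ ω, V ω ∂μ ≤ (η * ‖∑ k ∈ s, c k • unitVec p k‖) ^ q := by
    rw [integral_finsetSum _ fun k _ => (hGi k).const_mul _,
      Real.mul_rpow hη (norm_nonneg _), norm_sum_smul_unitVec_rpow hp, Finset.mul_sum]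
    refine Finset.sum_le_sum fun k _ => ?_
    rw [integral_const_mul, integral_indicator (hA k), mul_comm]
    exact mul_le_mul_of_nonneg_right (hκη k) (by positivity)
  have hWV : ∀ ω, |V ω ^ q⁻¹| ^ q = V ω := fun ω => by
    rw [abs_of_nonneg (Real.rpow_nonneg (hV0 ω) _), Real.rpow_inv_rpow (hV0 ω) hqpos.ne']
  have hW : MemLp (fun ω => V ω ^ q⁻¹) p μ := by
    refine (integrable_norm_rpow_iff
      (hVi.1.aemeasurable.pow_const q⁻¹).aestronglyMeasurable hp0 hp).1 ?_
    simpa only [Real.norm_eq_abs, ← hq, hWV] using hVi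
  have hWnorm : ‖hW.toLp _‖ ≤ η * ‖∑ k ∈ s, c k • unitVec p k‖ := by
    refine (Real.rpow_le_rpow_iff (norm_nonneg _) (by positivity) hqpos).1 (le_trans ?_ hVint)
    rw [Lp_norm_rpow_eq_integral hp]
    refine (integral_congr_ae ?_).le
    filter_upwards [hW.coeFn_toLp] with ω h
    rw [h, ← hq, hWV]
  have hle : ‖(T - S) (∑ k ∈ s, c k • unitVec p k)‖ ≤ ‖E + hW.toLp _‖ := by
    refine Lp.norm_le_norm_of_ae_le ?_
    rw [sub_apply]
    filter_upwards [hEω, Lp.coeFn_add E (hW.toLp _), hW.coeFn_toLp, hS _,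
      Lp.coeFn_sub (T (∑ k ∈ s, c k • unitVec p k)) (S (∑ k ∈ s, c k • unitVec p k)),
      map_sum_smul_unitVec_ae T c, map_unitVec_nonneg_ae hpos]
      with ω ⟨hE0, m, hm, hEm⟩ h2 h3 h4 h5 h6 h7
    rw [h5, Pi.sub_apply, h6, h4, h2, Pi.add_apply, h3, sum_smul_unitVec_apply]
    set g : ℕ → ℝ := fun k => T (unitVec p k) ω with hg
    have hW0 : 0 ≤ V ω ^ q⁻¹ := Real.rpow_nonneg (hV0 ω) _
    have hoff : |∑ k ∈ s, c k * g k - (if κ ω ∈ s then c (κ ω) else 0) * g (κ ω)| ≤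
        ∑ k ∈ s.erase (κ ω), |c k| * g k := by
      have heq : ∑ k ∈ s, c k * g k - (if κ ω ∈ s then c (κ ω) else 0) * g (κ ω) =
          ∑ k ∈ s.erase (κ ω), c k * g k := by
        split_ifs with h
        · rw [← Finset.sum_erase_add _ _ h, add_sub_cancel_right]
        · rw [zero_mul, sub_zero, Finset.erase_eq_of_notMem h]
      rw [heq]
      refine (Finset.abs_sum_le_sum_abs _ _).trans_eq (Finset.sum_congr rfl fun k _ => ?_)
      rw [abs_mul, abs_of_nonneg (h7 k)]
    have hterm : ∀ k, 0 ≤ |c k| * g k := fun k => mul_nonneg (abs_nonneg _) (h7 k)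
    refine hoff.trans ((?_ : _ ≤ E ω + V ω ^ q⁻¹).trans (le_abs_self _))
    by_cases hmκ : κ ω = m
    · have := Finset.sum_erase_add _ (fun k => |c k| * g k) hm
      rw [hmκ]
      linarith
    · have hle : |c m| * g m ≤ V ω ^ q⁻¹ := by
        rw [Real.le_rpow_inv_iff_of_pos (hterm m) (hV0 ω) hqpos,
          Real.mul_rpow (abs_nonneg _) (h7 m)]
        refine le_trans (le_of_eq ?_) (Finset.single_le_sum (fun k _ => hVterm k ω) hm)
        rw [Set.indicator_of_mem (show ω ∈ A m from hmκ), abs_of_nonneg (h7 m)]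
      have := Finset.sum_le_sum_of_subset_of_nonneg (s.erase_subset (κ ω))
        fun k _ _ => hterm k
      linarith
  calc ‖(T - S) (∑ k ∈ s, c k • unitVec p k)‖ ≤ ‖E‖ + ‖hW.toLp _‖ :=
        hle.trans (norm_add_le _ _)
    _ ≤ (4 * ε + η) * ‖∑ k ∈ s, c k • unitVec p k‖ := by rw [add_mul]; exact add_le_add hE hWnorm

/-- A positive `ε`-disjointness preserving operator `T : ℓ_p → L_p(μ)` lies within `20 ε` of a
disjointness preserving operator `S` with `0 ≤ S ≤ T`. -/
theorem exists_disjointness_preserving_near {Ω : Type*} [MeasurableSpace Ω] {μ : Measure Ω}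
    {p : ℝ≥0∞} [hp1 : Fact (1 ≤ p)] (hp : p ≠ ∞) {ε : ℝ} (hε : 0 < ε)
    {T : Lp ℝ p (Measure.count : Measure ℕ) →L[ℝ] Lp ℝ p μ}
    (hpos : ∀ x, 0 ≤ x → 0 ≤ T x)
    (hDP : ∀ x y, |x| ⊓ |y| = 0 → ‖|T x| ⊓ |T y|‖ ≤ ε * max ‖x‖ ‖y‖) :
    ∃ S : Lp ℝ p (Measure.count : Measure ℕ) →L[ℝ] Lp ℝ p μ,
      (∀ x y, |x| ⊓ |y| = 0 → |S x| ⊓ |S y| = 0) ∧ (∀ x, 0 ≤ x → 0 ≤ S x) ∧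
      (∀ x, 0 ≤ x → S x ≤ T x) ∧ ‖T - S‖ ≤ 20 * ε := by
  obtain ⟨κ, hκ, hκη⟩ := exists_selection_of_almost_disjointness_preserving hp hε hpos hDP
  obtain ⟨S, hS, hST⟩ := exists_selection_operator hpos hκ
  refine ⟨S, fun x y hxy => ?_, fun x hx => ?_, hST, ?_⟩
  · rw [Lp_count_abs_inf_abs_eq_zero_iff] at hxy
    refine Lp.ext ?_
    filter_upwards [hS x, hS y, Lp.coeFn_inf |S x| |S y|, Lp.coeFn_abs (S x),
      Lp.coeFn_abs (S y), Lp.coeFn_zero ℝ p μ] with ω h1 h2 h3 h4 h5 h6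
    rw [h3, Pi.inf_apply, h4, h5, h1, h2, h6]
    rcases hxy (κ ω) with h | h <;> simp [h] <;> positivity
  · refine (Lp.coeFn_nonneg _).1 ?_
    have hx0 : ∀ k, 0 ≤ x k := Measure.ae_count_iff.1 ((Lp.coeFn_nonneg x).2 hx)
    filter_upwards [hS x, map_unitVec_nonneg_ae hpos] with ω h1 h2
    rw [h1]
    exact mul_nonneg (hx0 _) (h2 _)
  · refine ContinuousLinearMap.opNorm_le_bound _ (by positivity) fun x => ?_
    refine (dense_span_unitVec hp).induction (P := fun x => ‖(T - S) x‖ ≤ 20 * ε * ‖x‖) ?_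
      (isClosed_le (T - S).continuous.norm (continuous_const.mul continuous_norm)) x
    rintro _ ⟨v, rfl⟩
    refine (norm_sub_selection_apply_sum_le hp hε.le hpos hDP hκ (by positivity) hκη hS
      v.1 v.2).trans_eq ?_
    ring

end

/-- For `1 < q < ∞` and `0 < ε < 8^{-1/q}`, a positive `ε`-disjointness
preserving operator `T : ℓ_q → L_q(μ)` admits a disjointness preserving `S` with `0 ≤ S ≤ T`
and `‖T - S‖ ≤ 2^8 ε + 2 √(2 ε ‖T‖ / 3)`. -/
theorem stmt12 {Ω : Type*} [MeasurableSpace Ω] (μ : Measure Ω)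
    (q : ℝ) (hq : 1 < q) [Fact (1 ≤ ENNReal.ofReal q)]
    (ε : ℝ) (hε : 0 < ε) (hε' : ε < (8 : ℝ) ^ (-(1 : ℝ) / q))
    (T : Lp ℝ (ENNReal.ofReal q) (Measure.count : Measure ℕ) →L[ℝ] Lp ℝ (ENNReal.ofReal q) μ)
    (hpos : ∀ x : Lp ℝ (ENNReal.ofReal q) (Measure.count : Measure ℕ), 0 ≤ x → 0 ≤ T x)
    (hDP : ∀ x y : Lp ℝ (ENNReal.ofReal q) (Measure.count : Measure ℕ), |x| ⊓ |y| = 0 →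
      ‖|T x| ⊓ |T y|‖ ≤ ε * max ‖x‖ ‖y‖) :
    ∃ S : Lp ℝ (ENNReal.ofReal q) (Measure.count : Measure ℕ) →L[ℝ] Lp ℝ (ENNReal.ofReal q) μ,
      (∀ x y : Lp ℝ (ENNReal.ofReal q) (Measure.count : Measure ℕ),
        |x| ⊓ |y| = 0 → |S x| ⊓ |S y| = 0) ∧
      (∀ x : Lp ℝ (ENNReal.ofReal q) (Measure.count : Measure ℕ), 0 ≤ x → 0 ≤ S x) ∧
      (∀ x : Lp ℝ (ENNReal.ofReal q) (Measure.count : Measure ℕ), 0 ≤ x → S x ≤ T x) ∧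
      ‖T - S‖ ≤ 2 ^ 8 * ε + 2 * Real.sqrt (2 * ε * ‖T‖ / 3) := by
  obtain ⟨S, h1, h2, h3, h4⟩ := exists_disjointness_preserving_near ofReal_ne_top hε hpos hDP
  refine ⟨S, h1, h2, h3, h4.trans ?_⟩
  have := Real.sqrt_nonneg (2 * ε * ‖T‖ / 3)
  linarith
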